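/- For w ∈ ℌ, one has Z(y(x+y)^s w x) = 0 for every integer s ≥ 0 if and only if w = 0. Equivalently, f(y, wx) = 0 ⇔ w = 0. -/

import Mathlib

open scoped BigOperators

noncomputable section

/-- `ℌ = ℚ⟨x,y⟩`, the free noncommutative polynomial ring in two indeterminates,
realized as the free `ℚ`-algebra on `Bool` (`false ↦ x`, `true ↦ y`). -/
abbrev H : Type := FreeAlgebra ℚ Bool

/-- The indeterminate `x`. -/
def Hx : H := FreeAlgebra.ι ℚ false

/-- The indeterminate `y`. -/
def Hy : H := FreeAlgebra.ι ℚ true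

/-- The multiple zeta value `ζ(k₁,…,k_r) = ∑_{0<n₁<⋯<n_r} 1/(n₁^{k₁}⋯n_r^{k_r})`. -/
def MZV (r : ℕ) (k : Fin r → ℕ) : ℝ :=
  ∑' n : {n : Fin r → ℕ // (∀ i, 0 < n i) ∧ StrictMono n},
    ∏ i, (1 : ℝ) / (n.1 i : ℝ) ^ (k i)

/-- `Z : yℌx → ℝ` is the `ℚ`-linear map with `Z(y x^{k₁-1} ⋯ y x^{k_r-1}) = ζ(k₁,…,k_r)`.
We encode it as a `ℚ`-linear map on all of `ℌ` whose values on the basis monomials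
`y x^{k₁-1} ⋯ y x^{k_r-1}` (with `k_r ≥ 2`) of `yℌx` are the multiple zeta values;
these values determine `Z` uniquely on the subspace `yℌx`. -/
def IsZetaMap (Z : H →ₗ[ℚ] ℝ) : Prop :=
  ∀ (r : ℕ) (k : Fin (r + 1) → ℕ), (∀ i, 1 ≤ k i) → 2 ≤ k (Fin.last r) →
    Z ((List.ofFn fun i => Hy * Hx ^ (k i - 1)).prod) = MZV (r + 1) k

/-- The family `f(A,B) = (Z(A(x+y)^s B))_{s ≥ 0}`. -/
def fam (Z : H →ₗ[ℚ] ℝ) (A B : H) : ℕ → ℝ := fun s => Z (A * (Hx + Hy) ^ s * B)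

/-- The `ℚ`-bilinear product `◇` on `ℌ`, characterized by its recursive defining
properties (which determine it uniquely). -/
def IsDiamond (d : H →ₗ[ℚ] H →ₗ[ℚ] H) : Prop :=
  (∀ w, d w 1 = w) ∧ (∀ w, d 1 w = w) ∧
  (∀ w1 w2, d (Hx * w1) (Hx * w2) = Hx * d w1 (Hx * w2) - Hx * d (Hy * w1) w2) ∧
  (∀ w1 w2, d (Hx * w1) (Hy * w2) = Hx * d w1 (Hy * w2) + Hy * d (Hx * w1) w2) ∧
  (∀ w1 w2, d (Hy * w1) (Hx * w2) = Hy * d w1 (Hx * w2) + Hx * d (Hy * w1) w2) ∧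
  (∀ w1 w2, d (Hy * w1) (Hy * w2) = Hy * d w1 (Hy * w2) - Hy * d (Hx * w1) w2)

/-- The harmonic product `∗` on `ℌ`, characterized by its recursive defining
properties (which determine it uniquely). -/
def IsHarmonic (st : H →ₗ[ℚ] H →ₗ[ℚ] H) : Prop :=
  (∀ w, st w 1 = w) ∧ (∀ w, st 1 w = w) ∧
  (∀ w1 w2, st (Hx * w1) w2 = Hx * st w1 w2) ∧
  (∀ w1 w2, st w1 (Hx * w2) = Hx * st w1 w2) ∧
  (∀ w1 w2, st (Hy * w1) (Hy * w2) = Hy * (st w1 (Hy * w2) + st (Hy * w1) w2 + Hx * st w1 w2))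

/-- The anti-automorphism `τ` of `ℌ` interchanging `x` and `y`, characterized by
being `ℚ`-linear, anti-multiplicative, unital, and swapping the generators. -/
def IsTau (t : H →ₗ[ℚ] H) : Prop :=
  t 1 = 1 ∧ (∀ a b, t (a * b) = t b * t a) ∧ t Hx = Hy ∧ t Hy = Hx

/-- The automorphism `φ` of `ℌ` with `φ(x) = x + y` and `φ(y) = -y`. -/
def phi : H →ₐ[ℚ] H := FreeAlgebra.lift ℚ (fun b => if b then -Hy else Hx + Hy)

/-- The automorphism `S₁` of `ℌ` with `S₁(x) = x` and `S₁(y) = x + y`. -/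
def S1 : H →ₐ[ℚ] H := FreeAlgebra.lift ℚ (fun b => if b then Hx + Hy else Hx)

/-- The Dirichlet series `∑_{n ≥ 1} a_n / n^s` (with `a n` the coefficient indexed by
`n + 1`) converges to `L` at `s`, i.e. its partial sums tend to `L`. -/
def DSConv (a : ℕ → ℝ) (s : ℕ) (L : ℝ) : Prop :=
  Filter.Tendsto (fun N => ∑ n ∈ Finset.range N, a n / ((n : ℝ) + 1) ^ s)
    Filter.atTop (nhds L)



noncomputable section
open Finset

def opX : Module.End ℚ (ℕ → ℝ) where
  toFun a := fun n => a n / n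
  map_add' a b := by ext n; simp [add_div]
  map_smul' q a := by ext n; simp [Rat.smul_def, mul_div_assoc]

def opY : Module.End ℚ (ℕ → ℝ) where
  toFun a := fun n => (∑ m ∈ range n, a m) / n
  map_add' a b := by ext n; simp [add_div, sum_add_distrib]
  map_smul' q a := by ext n; simp [Rat.smul_def, mul_div_assoc, ← mul_sum]

lemma opX_apply (a : ℕ → ℝ) (n : ℕ) : opX a n = a n / n := rfl
lemma opY_apply (a : ℕ → ℝ) (n : ℕ) : opY a n = (∑ m ∈ range n, a m) / n := rfl

def seqZ : ℕ → ℝ := fun n => if n = 0 then 1 else 0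
def seqO : ℕ → ℝ := fun n => 1 / n

lemma opY_seqZ : opY seqZ = seqO := by
  ext n
  rw [opY_apply]
  rcases n with _ | n
  · simp [seqO]
  · simp [seqO, seqZ]

def repA : H →ₐ[ℚ] (Module.End ℚ (ℕ → ℝ))ᵐᵒᵖ :=
  FreeAlgebra.lift ℚ (fun b => MulOpposite.op (if b then opY else opX))

def repB : H →ₐ[ℚ] (Module.End ℚ (ℕ → ℝ)) :=
  FreeAlgebra.lift ℚ (fun b => (if b then opX else opY))

def sA (w : H) : ℕ → ℝ := (repA w).unop seqZ
def sB (w : H) : ℕ → ℝ := repB w seqO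

lemma sA_one : sA 1 = seqZ := by simp [sA]
lemma sB_one : sB 1 = seqO := by simp [sB]
lemma sA_mul_x (w : H) : sA (w * Hx) = opX (sA w) := by simp [sA, Hx, repA]
lemma sA_mul_y (w : H) : sA (w * Hy) = opY (sA w) := by simp [sA, Hy, repA]
lemma sB_x_mul (w : H) : sB (Hx * w) = opY (sB w) := by simp [sB, Hx, repB]
lemma sB_y_mul (w : H) : sB (Hy * w) = opX (sB w) := by simp [sB, Hy, repB]
lemma sA_add (v w : H) : sA (v + w) = sA v + sA w := by simp [sA]
lemma sB_add (v w : H) : sB (v + w) = sB v + sB w := by simp [sB]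
lemma sA_smul (q : ℚ) (w : H) : sA (q • w) = (q : ℝ) • sA w := by
  ext n; simp [sA, Rat.smul_def]
lemma sB_smul (q : ℚ) (w : H) : sB (q • w) = (q : ℝ) • sB w := by
  ext n; simp [sB, Rat.smul_def]
lemma sA_y : sA Hy = seqO := by
  have := sA_mul_y 1
  rwa [one_mul, sA_one, opY_seqZ] at this

/-- The products `∏_{k=1}^n k/(k-z)`. -/
def pp {K : Type*} [Field K] (n : ℕ) (z : K) : K :=
  ∏ k ∈ range n, ((k : K) + 1) / ((k : K) + 1 - z)

def cc {K : Type*} [Field K] (n : ℕ) (z : K) : K := pp n z / n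

lemma pp_succ {K : Type*} [Field K] (n : ℕ) (z : K) :
    pp (n + 1) z = pp n z * (((n : K) + 1) / ((n : K) + 1 - z)) := by
  rw [pp, prod_range_succ]; rfl

lemma pp_eq {K : Type*} [Field K] [CharZero K] (z : K) (hz : ∀ k : ℕ, (k : K) + 1 - z ≠ 0)
    (n : ℕ) : pp n z = 1 + z * ∑ m ∈ range (n + 1), cc m z := by
  induction n with
  | zero => simp [pp, cc]
  | succ n ih =>
    rw [sum_range_succ, mul_add, ← add_assoc, ← ih, cc, pp_succ]
    have := hz n
    have h2 : (n : K) + 1 ≠ 0 := by exact_mod_cast Nat.succ_ne_zero n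
    push_cast
    field_simp
    ring

/-- The comparison sequence. -/
def cs (n : ℕ) : ℝ := cc n (1 / 2 : ℝ)

lemma half_ne (k : ℕ) : (k : ℝ) + 1 - 1 / 2 ≠ 0 := by
  have : (0 : ℝ) ≤ k := k.cast_nonneg
  intro h; linarith

lemma pp_half_pos (n : ℕ) : 0 < pp n (1 / 2 : ℝ) := by
  apply prod_pos
  intro k _
  have : (0 : ℝ) ≤ k := k.cast_nonneg
  apply div_pos <;> linarith

lemma cs_nonneg (n : ℕ) : 0 ≤ cs n := div_nonneg (pp_half_pos n).le n.cast_nonneg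

lemma cs_sum (n : ℕ) : pp n (1/2 : ℝ) = 1 + 1 / 2 * ∑ m ∈ range (n + 1), cs m :=
  pp_eq (1/2 : ℝ) half_ne n

lemma cs_zero : cs 0 = 0 := by simp [cs, cc]

lemma mul_cs (n : ℕ) (hn : n ≠ 0) : n * cs n = pp n (1/2 : ℝ) := by
  rw [cs, cc]; field_simp

lemma sum_cs_le (n : ℕ) : (∑ m ∈ range n, cs m) / n ≤ 2 * cs n := by
  rcases n with _ | n
  · simp [cs_zero]
  rw [div_le_iff₀ (by positivity)]
  have h := cs_sum (n + 1)
  rw [← mul_cs _ (Nat.succ_ne_zero n), sum_range_succ] at h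
  have := cs_nonneg (n + 1)
  linarith

lemma seqO_le (n : ℕ) : 1 / (n : ℝ) ≤ cs n := by
  rw [cs, cc]
  gcongr
  rw [cs_sum]
  have := sum_nonneg (fun m (_ : m ∈ range (n + 1)) => cs_nonneg m)
  linarith

lemma cs_step (n : ℕ) : cs (n + 2) / ((n + 2 : ℕ) : ℝ) ≤ 2 * (cs (n + 1) - cs (n + 2)) := by
  have h1 : cs (n + 2) = cs (n + 1) * ((n + 1) / (n + 2 - 1 / 2)) := by
    rw [cs, cs, cc, cc, pp_succ]
    have := half_ne (n + 1)
    push_cast at this ⊢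
    have h3 : (n : ℝ) + 2 - 1 / 2 ≠ 0 := by
      intro h; apply this; linarith
    field_simp
    ring
  have h0 := cs_nonneg (n + 1)
  have hn : (0 : ℝ) ≤ n := n.cast_nonneg
  have e : 2 * (cs (n + 1) - cs (n + 2)) - cs (n + 2) / ((n + 2 : ℕ) : ℝ)
     = cs (n + 1) * (1 / ((n + 2 - 1 / 2) * (n + 2))) := by
    rw [h1]
    have h3 : (n : ℝ) * 2 + 3 ≠ 0 := by positivity
    have h4 : (n : ℝ) + 2 - 1 / 2 = (n * 2 + 3) / 2 := by ring
    rw [h4]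
    push_cast
    field_simp
    ring
  have : 0 ≤ cs (n + 1) * (1 / (((n : ℝ) + 2 - 1 / 2) * (n + 2))) := by
    apply mul_nonneg h0
    have : 0 < (n : ℝ) + 2 - 1 / 2 := by linarith
    positivity
  linarith

lemma summable_cs : Summable (fun n => cs n / n) := by
  rw [← summable_nat_add_iff 2]
  apply summable_of_sum_range_le (c := 2 * cs 1)
  · intro n; exact div_nonneg (cs_nonneg _) (Nat.cast_nonneg _)
  · intro n
    have : ∑ i ∈ range n, cs (i + 2) / ((i + 2 : ℕ) : ℝ) ≤ 2 * (cs 1 - cs (n + 1)) := by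
      induction n with
      | zero => simp
      | succ n ih =>
        rw [sum_range_succ]
        have := cs_step n
        linarith
    have := cs_nonneg (n + 1)
    linarith

/-- Boundedness by the comparison sequence. -/
def Bd (a : ℕ → ℝ) : Prop := ∃ K, ∀ n, |a n| ≤ K * cs n

lemma Bd.add {a b : ℕ → ℝ} (ha : Bd a) (hb : Bd b) : Bd (a + b) := by
  obtain ⟨K, hK⟩ := ha
  obtain ⟨L, hL⟩ := hb
  refine ⟨K + L, fun n => (abs_add_le _ _).trans ?_⟩
  have := hK n
  have := hL n
  linarith

lemma Bd.smul {a : ℕ → ℝ} (r : ℝ) (ha : Bd a) : Bd (r • a) := by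
  obtain ⟨K, hK⟩ := ha
  refine ⟨|r| * K, fun n => ?_⟩
  rw [Pi.smul_apply, smul_eq_mul, abs_mul, mul_assoc]
  exact mul_le_mul_of_nonneg_left (hK n) (abs_nonneg r)

lemma Bd.abs {a : ℕ → ℝ} (ha : Bd a) : Bd (fun n => |a n|) := by
  obtain ⟨K, hK⟩ := ha
  exact ⟨K, fun n => by rw [abs_abs]; exact hK n⟩

lemma Bd.X {a : ℕ → ℝ} (ha : Bd a) : Bd (opX a) := by
  obtain ⟨K, hK⟩ := ha
  refine ⟨K, fun n => le_trans ?_ (hK n)⟩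
  rw [opX_apply, abs_div, Nat.abs_cast]
  rcases n with _ | n
  · simp
  · apply div_le_self (abs_nonneg _)
    push_cast; linarith [(n.cast_nonneg : (0 : ℝ) ≤ n)]

lemma Bd.Y {a : ℕ → ℝ} (ha : Bd a) : Bd (opY a) := by
  obtain ⟨K, hK⟩ := ha
  have hK0 : 0 ≤ K := by
    have h1 := (abs_nonneg _).trans (hK 1)
    have h2 := seqO_le 1
    by_contra h
    push Not at h
    simp at h2
    nlinarith
  refine ⟨2 * K, fun n => ?_⟩
  rw [opY_apply, abs_div, Nat.abs_cast]
  calc |∑ m ∈ range n, a m| / n ≤ (∑ m ∈ range n, K * cs m) / n := by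
        gcongr
        exact (abs_sum_le_sum_abs _ _).trans (sum_le_sum fun m _ => hK m)
    _ = K * ((∑ m ∈ range n, cs m) / n) := by rw [← mul_sum, mul_div_assoc]
    _ ≤ K * (2 * cs n) := by gcongr; exact sum_cs_le n
    _ = 2 * K * cs n := by ring

lemma Bd_seqO : Bd seqO := ⟨1, fun n => by
  rw [seqO, abs_of_nonneg (by positivity), one_mul]; exact seqO_le n⟩

lemma Bd_repA (w : H) : ∀ a, Bd a → Bd ((repA w).unop a) := by
  induction w using FreeAlgebra.induction with
  | grade0 r =>
    intro a ha
    have : ((repA (algebraMap ℚ H r)).unop a) = (r : ℝ) • a := by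
      ext n
      simp [Algebra.algebraMap_eq_smul_one, Rat.smul_def]
    rw [this]; exact ha.smul _
  | grade1 b =>
    intro a ha
    cases b
    · simpa [repA] using ha.X
    · simpa [repA] using ha.Y
  | mul v w hv hw => intro a ha; simpa using hw _ (hv _ ha)
  | add v w hv hw => intro a ha; simpa using (hv a ha).add (hw a ha)

lemma Bd_repB (w : H) : ∀ a, Bd a → Bd (repB w a) := by
  induction w using FreeAlgebra.induction with
  | grade0 r =>
    intro a ha
    have : (repB (algebraMap ℚ H r) a) = (r : ℝ) • a := by
      ext n
      simp [Algebra.algebraMap_eq_smul_one, Rat.smul_def]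
    rw [this]; exact ha.smul _
  | grade1 b =>
    intro a ha
    cases b
    · simpa [repB] using ha.Y
    · simpa [repB] using ha.X
  | mul v w hv hw => intro a ha; simpa using hv _ (hw _ ha)
  | add v w hv hw => intro a ha; simpa using (hv a ha).add (hw a ha)

lemma Bd_sA (P : H) : Bd (sA (Hy * P)) := by
  have : sA (Hy * P) = (repA P).unop (sA Hy) := by simp [sA]
  rw [this, sA_y]
  exact Bd_repA P _ Bd_seqO

lemma Bd_sB (P : H) : Bd (sB P) := Bd_repB P _ Bd_seqO

end


noncomputable section
open Finset Filter Topology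

/-- The connector. -/
def ck (n m : ℕ) : ℝ := 1 / ((n + m).choose n : ℝ)

lemma ck_pos (n m : ℕ) : 0 < ck n m := by
  have := Nat.choose_pos (Nat.le_add_right n m)
  rw [ck]; positivity

lemma ck_comm (n m : ℕ) : ck n m = ck m n := by
  rw [ck, ck, Nat.add_comm m n, Nat.choose_symm_add]

lemma ck_zero (n : ℕ) : ck n 0 = 1 := by simp [ck]

lemma ck_succ (n m : ℕ) : ck n (m + 1) * (n + m + 1) = ck n m * (m + 1) := by
  have h := Nat.add_one_mul_choose_eq (n + m) m
  have e1 : (n + m + 1).choose (m + 1) = (n + (m + 1)).choose n := by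
    rw [Nat.add_assoc, Nat.choose_symm_add]
  have e2 : (n + m).choose m = (n + m).choose n := by
    rw [Nat.choose_symm_add]
  rw [e1, e2] at h
  have h' : ((n : ℝ) + m + 1) * ((n + m).choose n : ℝ) = ((n + (m + 1)).choose n : ℝ) * (m + 1) := by
    exact_mod_cast h
  have p1 := Nat.choose_pos (Nat.le_add_right n m)
  have p2 := Nat.choose_pos (Nat.le_add_right n (m + 1))
  rw [ck, ck]
  field_simp
  linarith

lemma ck_tele (n m : ℕ) :
    ck n (m + 1) / ((m + 1 : ℕ) : ℝ) * n = ck n m - ck n (m + 1) := by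
  have := ck_succ n m
  push_cast
  field_simp
  linarith

lemma ck_le (n m : ℕ) (hn : n ≠ 0) (hm : m ≠ 0) : ck n m ≤ 1 / (n * m) := by
  rw [ck]
  apply one_div_le_one_div_of_le
  · positivity
  · have : n * m ≤ (n + m).choose n := by
      rw [Nat.add_choose_eq]
      have := Finset.single_le_sum (f := fun ij : ℕ × ℕ => n.choose ij.1 * m.choose ij.2)
        (fun _ _ => Nat.zero_le _) (show (n - 1, 1) ∈ antidiagonal n by simp; omega)
      simp only [Nat.choose_one_right] at this
      rw [Nat.choose_symm (by omega)] at this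
      simpa using this
    exact_mod_cast this

lemma ck_tendsto (n : ℕ) (hn : n ≠ 0) : Tendsto (ck n) atTop (𝓝 0) := by
  apply squeeze_zero' (g := fun m : ℕ => 1 / (m : ℝ)) (Eventually.of_forall fun m => (ck_pos n m).le) _
    tendsto_one_div_atTop_nhds_zero_nat
  filter_upwards [eventually_gt_atTop 0] with m hm
  refine (ck_le n m hn hm.ne').trans ?_
  apply one_div_le_one_div_of_le (by positivity)
  have : (1 : ℝ) ≤ n := by exact_mod_cast Nat.one_le_iff_ne_zero.2 hn
  have : (0 : ℝ) < m := by exact_mod_cast hm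
  nlinarith

lemma ck_hasSum (n m : ℕ) (hn : n ≠ 0) :
    HasSum (fun j : ℕ => if m < j then ck n j / j else 0) (ck n m / n) := by
  rw [hasSum_iff_tendsto_nat_of_nonneg]
  · rw [← tendsto_add_atTop_iff_nat (m + 1)]
    have key : ∀ k, ∑ i ∈ range (k + (m + 1)), (if m < i then ck n i / i else 0)
        = (ck n m - ck n (m + k)) / n := by
      intro k
      induction k with
      | zero =>
        simp only [zero_add, add_zero, sub_self, zero_div]
        apply sum_eq_zero
        intro i hi
        rw [if_neg]; simp at hi; omega
      | succ k ih =>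
        rw [show k + 1 + (m + 1) = (k + (m + 1)) + 1 by ring, sum_range_succ, ih, if_pos (by omega)]
        have := ck_tele n (m + k)
        rw [show m + (k + 1) = m + k + 1 by ring, show k + (m + 1) = m + k + 1 by ring]
        have hn' : (n : ℝ) ≠ 0 := by exact_mod_cast hn
        rw [eq_div_iff hn', add_mul, this]
        field_simp
        ring
    simp_rw [key]
    have h : Tendsto (fun k => ck n (m + k)) atTop (𝓝 0) := by
      have := (tendsto_add_atTop_iff_nat m).2 (ck_tendsto n hn)
      simpa [add_comm] using this
    simpa using (tendsto_const_nhds.sub h).div_const (n : ℝ)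
  · intro i
    split_ifs
    · exact div_nonneg (ck_pos _ _).le (Nat.cast_nonneg _)
    · exact le_rfl

/-- Termwise pairing. -/
def pf (a b : ℕ → ℝ) (p : ℕ × ℕ) : ℝ := a p.1 * b p.2 * ck p.1 p.2

def pair (a b : ℕ → ℝ) : ℝ := ∑' p, pf a b p

lemma pf_le {a b : ℕ → ℝ} {K L : ℝ} (ha : ∀ n, |a n| ≤ K * cs n) (hb : ∀ n, |b n| ≤ L * cs n)
    (p : ℕ × ℕ) : ‖pf a b p‖ ≤ (K * (cs p.1 / p.1)) * (L * (cs p.2 / p.2)) := by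
  obtain ⟨n, m⟩ := p
  rw [pf, Real.norm_eq_abs, abs_mul, abs_mul, abs_of_pos (ck_pos _ _)]
  simp only
  have h1 := ha n
  have h2 := hb m
  have a1 := abs_nonneg (a n)
  have a2 := abs_nonneg (b m)
  by_cases hn : n = 0
  · subst hn; simp [cs_zero] at h1; simp [h1]
  by_cases hm : m = 0
  · subst hm; simp [cs_zero] at h2; simp [h2]
  calc |a n| * |b m| * ck n m ≤ (K * cs n) * (L * cs m) * (1 / (n * m)) := by
        apply mul_le_mul _ (ck_le n m hn hm) (ck_pos _ _).le
        · exact mul_nonneg (a1.trans h1) (a2.trans h2)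
        · exact mul_le_mul h1 h2 a2 (a1.trans h1)
    _ = _ := by field_simp

lemma pf_summable {a b : ℕ → ℝ} (ha : Bd a) (hb : Bd b) : Summable (pf a b) := by
  obtain ⟨K, hK⟩ := ha
  obtain ⟨L, hL⟩ := hb
  refine Summable.of_norm_bounded ?_ (pf_le hK hL)
  exact (summable_cs.mul_left K).mul_of_nonneg (summable_cs.mul_left L)
    (fun n => by
      have := (abs_nonneg _).trans (hK n)
      show 0 ≤ K * (cs n / n)
      rw [← mul_div_assoc]; exact div_nonneg this (Nat.cast_nonneg _))
    (fun n => by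
      have := (abs_nonneg _).trans (hL n)
      show 0 ≤ L * (cs n / n)
      rw [← mul_div_assoc]; exact div_nonneg this (Nat.cast_nonneg _))

lemma Bd.zero {a : ℕ → ℝ} (ha : Bd a) : a 0 = 0 := by
  obtain ⟨K, hK⟩ := ha
  simpa [cs_zero] using hK 0

lemma pair_comm (a b : ℕ → ℝ) : pair a b = pair b a := by
  rw [pair, pair, ← (Equiv.prodComm ℕ ℕ).tsum_eq]
  apply tsum_congr
  rintro ⟨n, m⟩
  simp only [pf, Equiv.prodComm_apply, Prod.swap_prod_mk]
  rw [ck_comm m n]; ring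

lemma pair_eq {a b : ℕ → ℝ} (ha : Bd a) (hb : Bd b) :
    pair a b = ∑' n, a n * ∑' m, b m * ck n m := by
  rw [pair, (pf_summable ha hb).tsum_prod]
  apply tsum_congr
  intro n
  rw [← tsum_mul_left]
  apply tsum_congr
  intro m
  simp [pf, mul_assoc]

lemma Bd.row {b : ℕ → ℝ} (hb : Bd b) (n : ℕ) (hn : n ≠ 0) : Summable (fun m => b m * ck n m) := by
  have := (pf_summable Bd_seqO hb).prod_factor n
  have h := this.mul_left (n : ℝ)
  refine h.congr fun m => ?_
  simp only [pf, seqO]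
  field_simp

lemma inner_Y {b : ℕ → ℝ} (hb : Bd b) (n : ℕ) (hn : n ≠ 0) :
    ∑' m, opY b m * ck n m = (∑' m, b m * ck n m) / n := by
  have hS : Summable (Function.uncurry fun m j : ℕ => b m * (if m < j then ck n j / j else 0)) := by
    rw [← summable_abs_iff, summable_prod_of_nonneg (fun _ => abs_nonneg _)]
    simp only [Function.uncurry, abs_mul]
    have h1 : ∀ m, HasSum (fun j : ℕ => |b m| * |if m < j then ck n j / j else 0|)
        (|b m| * (ck n m / n)) := by
      intro m
      apply HasSum.mul_left
      suffices e : (fun j : ℕ => |if m < j then ck n j / j else 0|)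
          = fun j : ℕ => if m < j then ck n j / j else 0 by
        rw [e]; exact ck_hasSum n m hn
      ext j
      apply abs_of_nonneg
      split_ifs
      · exact div_nonneg (ck_pos _ _).le (Nat.cast_nonneg _)
      · exact le_rfl
    refine ⟨fun m => (h1 m).summable, ?_⟩
    refine ((hb.abs.row n hn).div_const (n : ℝ)).congr fun m => ?_
    rw [(h1 m).tsum_eq, mul_div_assoc]
  have h := hS.tsum_comm
  rw [← tsum_div_const]
  calc _ = ∑' j, ∑' m, b m * (if m < j then ck n j / j else 0) := by
        apply tsum_congr
        intro j
        rw [tsum_eq_sum (s := range j)]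
        · rw [opY_apply, div_mul_eq_mul_div, sum_mul, sum_div]
          apply sum_congr rfl
          intro m hm
          rw [if_pos (by simpa using hm), mul_div_assoc]
        · intro m hm
          rw [if_neg (by simpa using hm), mul_zero]
    _ = _ := h
    _ = _ := by
        apply tsum_congr
        intro m
        rw [tsum_mul_left, (ck_hasSum n m hn).tsum_eq, mul_div_assoc]

lemma pair_XY {a b : ℕ → ℝ} (ha : Bd a) (hb : Bd b) : pair (opX a) b = pair a (opY b) := by
  rw [pair_eq ha.X hb, pair_eq ha hb.Y]
  apply tsum_congr
  intro n
  by_cases hn : n = 0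
  · subst hn; rw [ha.zero, ha.X.zero]; simp
  rw [inner_Y hb n hn, opX_apply]
  ring

lemma pair_YX {a b : ℕ → ℝ} (ha : Bd a) (hb : Bd b) : pair (opY a) b = pair a (opX b) := by
  rw [pair_comm, ← pair_XY hb ha, pair_comm]

lemma pair_add_left {a a' b : ℕ → ℝ} (ha : Bd a) (ha' : Bd a') (hb : Bd b) :
    pair (a + a') b = pair a b + pair a' b := by
  rw [pair, pair, pair, ← (pf_summable ha hb).tsum_add (pf_summable ha' hb)]
  apply tsum_congr; intro p; simp [pf]; ring

lemma pair_add_right {a b b' : ℕ → ℝ} (ha : Bd a) (hb : Bd b) (hb' : Bd b') :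
    pair a (b + b') = pair a b + pair a b' := by
  rw [pair_comm, pair_add_left hb hb' ha, pair_comm a, pair_comm a]

lemma pair_smul_left (r : ℝ) (a b : ℕ → ℝ) : pair (r • a) b = r * pair a b := by
  rw [pair, pair, ← tsum_mul_left]
  apply tsum_congr; intro p; simp [pf]; ring

lemma pair_smul_right (r : ℝ) (a b : ℕ → ℝ) : pair a (r • b) = r * pair a b := by
  rw [pair_comm, pair_smul_left, pair_comm]

lemma pair_seqO {a : ℕ → ℝ} (ha : Bd a) : pair a seqO = ∑' n, a n / n := by
  rw [pair_eq ha Bd_seqO]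
  apply tsum_congr
  intro n
  by_cases hn : n = 0
  · subst hn; rw [ha.zero]; simp
  have := (ck_hasSum n 0 hn).tsum_eq
  rw [ck_zero] at this
  rw [div_eq_mul_one_div, ← this]
  congr 1
  apply tsum_congr
  intro j
  by_cases hj : j = 0
  · simp [hj, seqO]
  · rw [if_pos (by omega), seqO]; ring

/-- Transport relation. -/
lemma transport (w : H) : ∀ P v : H,
    pair (sA (Hy * P)) (sB (w * v)) = pair (sA (Hy * (P * w))) (sB v) := by
  induction w using FreeAlgebra.induction with
  | grade0 r =>
    intro P v
    rw [Algebra.algebraMap_eq_smul_one, smul_mul_assoc, one_mul, mul_smul_comm, mul_one,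
      mul_smul_comm, sA_smul, sB_smul, pair_smul_left, pair_smul_right]
  | grade1 b =>
    intro P v
    cases b
    · rw [← Hx, sB_x_mul, ← mul_assoc, sA_mul_x, pair_XY (Bd_sA _) (Bd_sB _)]
    · rw [← Hy, sB_y_mul, ← mul_assoc, sA_mul_y, pair_YX (Bd_sA _) (Bd_sB _)]
  | mul u w hu hw =>
    intro P v
    rw [mul_assoc, hu, hw, mul_assoc]
  | add u w hu hw =>
    intro P v
    rw [add_mul, sB_add, mul_add, mul_add, sA_add, pair_add_left (Bd_sA _) (Bd_sA _) (Bd_sB _),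
      pair_add_right (Bd_sA _) (Bd_sB _) (Bd_sB _), hu, hw]

end


noncomputable section
open Finset Filter Topology

lemma ck_succ_left (n m : ℕ) : ck (n + 1) m * (n + m + 1) = ck n m * (n + 1) := by
  rw [ck_comm (n + 1), ck_comm n]
  have := ck_succ m n
  linarith

lemma ck_anti (n m : ℕ) : ck n (m + 1) ≤ ck n m := by
  have h := ck_tele n m
  have : 0 ≤ ck n (m + 1) / ((m + 1 : ℕ) : ℝ) * n :=
    mul_nonneg (div_nonneg (ck_pos _ _).le (Nat.cast_nonneg _)) (Nat.cast_nonneg _)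
  linarith

lemma ck_antitone (n : ℕ) : Antitone (ck n) := antitone_nat_of_succ_le (ck_anti n)

/-- Uniqueness of factorial series. -/
lemma factorial_unique (γ : ℕ → ℝ) (h0 : γ 0 = 0) (hs : Summable fun n => |γ n| * ck 1 n)
    (hz : ∀ N : ℕ, ∑' n, γ n * ck (N + 1) n = 0) : γ = 0 := by
  ext n
  induction n using Nat.strong_induction_on with
  | _ d ih =>
  simp only [Pi.zero_apply] at ih ⊢
  by_cases hd : d = 0
  · rw [hd, h0]
  -- the ratio
  let R : ℕ → ℕ → ℝ := fun N n => ck (N + 1) n / ck (N + 1) d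
  have hR0 : ∀ N n, 0 ≤ R N n := fun N n => div_nonneg (ck_pos _ _).le (ck_pos _ _).le
  have hRanti : ∀ n, d ≤ n → ∀ N, R N n ≤ R 0 n := by
    intro n hn N
    induction N with
    | zero => exact le_rfl
    | succ N ih =>
      refine le_trans ?_ ih
      have h1 := ck_succ_left (N + 1) n
      have h2 := ck_succ_left (N + 1) d
      have p1 := ck_pos (N + 1) n
      have p2 := ck_pos (N + 1) d
      have p3 := ck_pos (N + 1 + 1) n
      have p4 := ck_pos (N + 1 + 1) d
      simp only [R]
      push_cast at h1 h2
      have e1 : ck (N + 1 + 1) n = ck (N + 1) n * ((N : ℝ) + 1 + 1) / (N + 1 + n + 1) := by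
        rw [eq_div_iff (by positivity)]; exact h1
      have e2 : ck (N + 1 + 1) d = ck (N + 1) d * ((N : ℝ) + 1 + 1) / (N + 1 + d + 1) := by
        rw [eq_div_iff (by positivity)]; exact h2
      have hdn : (d : ℝ) ≤ n := by exact_mod_cast hn
      have : ck (N + 1 + 1) n / ck (N + 1 + 1) d
          = ck (N + 1) n / ck (N + 1) d * (((N : ℝ) + 1 + d + 1) / (N + 1 + n + 1)) := by
        rw [e1, e2]; field_simp
      rw [this]
      apply mul_le_of_le_one_right (by positivity)
      rw [div_le_one (by positivity)]
      linarith
  have hRlim : ∀ n, d < n → Tendsto (fun N => R N n) atTop (𝓝 0) := by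
    intro n hn
    have hb : Tendsto (fun N : ℕ => ((d : ℝ) + 1) * (1 / ((N : ℝ) + 1))) atTop (𝓝 0) := by
      simpa using tendsto_one_div_add_atTop_nhds_zero_nat.const_mul ((d : ℝ) + 1)
    refine squeeze_zero (fun N => hR0 N n) (fun N => ?_) hb
    have h1 : ck (N + 1) n ≤ ck (N + 1) (d + 1) := ck_antitone _ hn
    have h2 := ck_succ (N + 1) d
    have p2 := ck_pos (N + 1) d
    simp only [R]
    rw [div_le_iff₀ p2]
    refine h1.trans ?_
    push_cast at h2
    have e1 : ck (N + 1) (d + 1) = ck (N + 1) d * ((d : ℝ) + 1) / (N + 1 + d + 1) := by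
      rw [eq_div_iff (by positivity)]; exact h2
    rw [e1, div_eq_mul_one_div, mul_comm (ck (N + 1) d), mul_right_comm]
    gcongr
    linarith [(d.cast_nonneg : (0 : ℝ) ≤ d)]
  have hlim : Tendsto (fun N => ∑' n, γ n * R N n) atTop (𝓝 (∑' n, if n = d then γ d else 0)) := by
    refine tendsto_tsum_of_dominated_convergence (bound := fun n => |γ n| * R 0 n) ?_ ?_ ?_
    · refine (hs.div_const (ck 1 d)).congr fun n => ?_
      simp [R, mul_div_assoc]
    · intro n
      rcases lt_trichotomy n d with h | h | h
      · simp [ih n h, h.ne]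
      · subst h
        have : ∀ N, R N n = 1 := fun N => div_self (ck_pos _ _).ne'
        simp [this]
      · simpa [h.ne'] using (hRlim n h).const_mul (γ n)
    · refine Eventually.of_forall fun N n => ?_
      rw [Real.norm_eq_abs, abs_mul, abs_of_nonneg (hR0 N n)]
      by_cases h : n < d
      · simp [ih n h]
      · exact mul_le_mul_of_nonneg_left (hRanti n (not_lt.1 h) N) (abs_nonneg _)
  have hzero : ∀ N, ∑' n, γ n * R N n = 0 := by
    intro N
    simp only [R, ← mul_div_assoc]
    rw [tsum_div_const, hz, zero_div]
  simp only [hzero, tsum_ite_eq] at hlim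
  exact (tendsto_nhds_unique hlim tendsto_const_nhds)

/-- The sequences attached to `y (x+y)^s`. -/
def aS (s : ℕ) : ℕ → ℝ := sA (Hy * (Hx + Hy) ^ s)

lemma aS_zero : aS 0 = seqO := by simp [aS, sA_y]

lemma aS_succ (s n : ℕ) : aS (s + 1) n = (∑ m ∈ range (n + 1), aS s m) / n := by
  rw [aS, pow_succ, mul_add, mul_add, ← mul_assoc, ← mul_assoc, sA_add, sA_mul_x, sA_mul_y,
    Pi.add_apply, opX_apply, opY_apply, sum_range_succ, aS]
  ring

lemma aS_nonneg (s n : ℕ) : 0 ≤ aS s n := by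
  induction s generalizing n with
  | zero => rw [aS_zero, seqO]; positivity
  | succ s ih => rw [aS_succ]; exact div_nonneg (sum_nonneg fun m _ => ih m) (Nat.cast_nonneg _)

lemma aS_at_zero (s : ℕ) : aS s 0 = 0 := (Bd_sA _).zero

lemma aS_le_one (s n : ℕ) : aS s n ≤ 1 := by
  induction s generalizing n with
  | zero =>
    rw [aS_zero, seqO]
    rcases n with _ | n
    · simp
    · rw [div_le_one (by positivity)]; push_cast; linarith [(n.cast_nonneg : (0 : ℝ) ≤ n)]
  | succ s ih =>
    rw [aS_succ]
    rcases n with _ | n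
    · simp
    rw [div_le_one (by positivity), sum_range_succ', aS_at_zero, add_zero]
    calc _ ≤ ∑ m ∈ range (n + 1), (1 : ℝ) := sum_le_sum fun m _ => ih _
      _ = _ := by simp

lemma ne_of_norm_lt {z : ℂ} (hz : ‖z‖ < 1) (k : ℕ) : (k : ℂ) + 1 - z ≠ 0 := by
  intro h
  have : z = ((k + 1 : ℕ) : ℂ) := by push_cast; linear_combination -h
  rw [this, Complex.norm_natCast] at hz
  push_cast at hz
  linarith [(k.cast_nonneg : (0 : ℝ) ≤ k)]

lemma aS_gen_summable {z : ℂ} (hz : ‖z‖ < 1) (n : ℕ) : Summable fun s => (aS s n : ℂ) * z ^ s := by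
  refine Summable.of_norm_bounded (summable_geometric_of_lt_one (norm_nonneg z) hz) fun s => ?_
  rw [norm_mul, norm_pow, Complex.norm_real, Real.norm_eq_abs, abs_of_nonneg (aS_nonneg s n)]
  exact mul_le_of_le_one_left (by positivity) (aS_le_one s n)

lemma aS_gen {z : ℂ} (hz : ‖z‖ < 1) (n : ℕ) : ∑' s, (aS s n : ℂ) * z ^ s = cc n z := by
  induction n using Nat.strong_induction_on with
  | _ n ih =>
  rcases n with _ | n
  · simp [aS_at_zero, cc]
  set T := ∑' s, (aS s (n + 1) : ℂ) * z ^ s with hT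
  have hn : ((n : ℂ) + 1) ≠ 0 := by exact_mod_cast Nat.succ_ne_zero n
  have h1 : T = 1 / ((n : ℂ) + 1) + z * (∑ m ∈ range (n + 1), cc m z + T) / (n + 1) := by
    refine ((aS_gen_summable hz (n + 1)).tsum_eq_zero_add).trans ?_
    congr 1
    · simp [aS_zero, seqO]
    · have e : ∀ s, (aS (s + 1) (n + 1) : ℂ) * z ^ (s + 1)
          = (∑ m ∈ range (n + 2), (aS s m : ℂ) * z ^ s) * (z / (n + 1)) := by
        intro s
        rw [aS_succ, ← sum_mul]
        push_cast
        ring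
      simp_rw [e]
      rw [tsum_mul_right, Summable.tsum_finsetSum (fun m _ => aS_gen_summable hz m),
        sum_range_succ, sum_congr rfl (fun m hm => ih m (by simpa using hm)), ← hT]
      ring
  have h2 := pp_eq z (ne_of_norm_lt hz) n
  have h3 := pp_succ n z
  have h4 := ne_of_norm_lt hz n
  have h5 : T * (n + 1 - z) = pp n z := by
    rw [h2]
    have : T * (n + 1) = 1 + z * (∑ m ∈ range (n + 1), cc m z + T) := by
      nth_rewrite 1 [h1]
      field_simp
    linear_combination this
  rw [cc, h3, ← h5]
  push_cast
  field_simp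

lemma half_le_norm {z : ℂ} (hz : z.re < 1 / 2) (k : ℕ) : (k : ℝ) + 1 - 1 / 2 ≤ ‖(k : ℂ) + 1 - z‖ := by
  refine le_trans ?_ (Complex.re_le_norm _)
  simp; linarith

lemma cc_norm_le {z : ℂ} (hz : z.re < 1 / 2) (n : ℕ) : ‖cc n z‖ ≤ cs n := by
  rw [cc, cs, cc, norm_div, Complex.norm_natCast]
  gcongr
  rw [pp, pp, norm_prod]
  apply prod_le_prod (fun _ _ => norm_nonneg _)
  intro k _
  have hk : (0 : ℝ) ≤ k := k.cast_nonneg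
  rw [norm_div]
  have e : ‖(k : ℂ) + 1‖ = k + 1 := by
    have := Complex.norm_natCast (k + 1)
    push_cast at this; exact this
  rw [e]
  apply div_le_div_of_nonneg_left (by positivity) (by linarith) (half_le_norm hz k)

lemma cc_diff (n : ℕ) : DifferentiableOn ℂ (fun z => cc n z) {z : ℂ | z.re < 1 / 2} := by
  unfold cc pp
  apply DifferentiableOn.div_const
  apply DifferentiableOn.fun_finsetProd
  intro k _
  apply DifferentiableOn.div (by fun_prop) (by fun_prop)
  intro z hz h
  have := half_le_norm hz k
  rw [h, norm_zero] at this
  linarith [(k.cast_nonneg : (0 : ℝ) ≤ k)]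

lemma pp_neg (N n : ℕ) : pp n (-(N : ℂ)) = (ck N n : ℂ) := by
  induction n with
  | zero => simp [pp, ck_zero]
  | succ n ih =>
    rw [pp_succ, ih]
    have h := ck_succ N n
    have h' : (ck N (n + 1) : ℂ) * (N + n + 1) = ck N n * (n + 1) := by exact_mod_cast h
    have : (n : ℂ) + 1 - -(N : ℂ) ≠ 0 := by
      have : ((n + 1 + N : ℕ) : ℂ) ≠ 0 := by
        rw [Nat.cast_ne_zero]; omega
      push_cast at this; rwa [sub_neg_eq_add]
    rw [mul_div_assoc', div_eq_iff this]
    linear_combination -h'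

lemma aS_le_cs (s n : ℕ) : aS s n ≤ 2 ^ s * cs n := by
  induction s generalizing n with
  | zero => simpa [aS_zero, seqO] using seqO_le n
  | succ s ih =>
    rw [aS_succ]
    rcases n with _ | n
    · simp [cs_zero]
    have h := cs_sum (n + 1)
    rw [← mul_cs _ (Nat.succ_ne_zero n)] at h
    rw [div_le_iff₀ (by positivity)]
    calc _ ≤ ∑ m ∈ range (n + 1 + 1), 2 ^ s * cs m := sum_le_sum fun m _ => ih m
      _ = 2 ^ s * ∑ m ∈ range (n + 1 + 1), cs m := by rw [mul_sum]
      _ ≤ 2 ^ s * (2 * (((n + 1 : ℕ) : ℝ) * cs (n + 1))) := by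
          gcongr; linarith
      _ = _ := by ring

lemma Bd_cs : Bd cs := ⟨1, fun n => by rw [abs_of_nonneg (cs_nonneg n), one_mul]⟩

/-- Vanishing of all the pairings forces `b = 0`. -/
lemma vanish {b : ℕ → ℝ} (hb : Bd b) (h : ∀ s, pair (aS s) b = 0) : b = 0 := by
  set B : ℕ → ℝ := fun n => if n = 0 then 0 else ∑' m, b m * ck n m with hB
  have hB0 : B 0 = 0 := by simp [hB]
  have hpair : ∀ a, Bd a → pair a b = ∑' n, a n * B n := by
    intro a ha
    rw [pair_eq ha hb]
    apply tsum_congr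
    intro n
    by_cases hn : n = 0
    · subst hn; rw [ha.zero]; simp
    · simp [hB, hn]
  have hsum : Summable fun n => |B n| * cs n := by
    have := (pf_summable Bd_cs hb.abs).prod
    refine Summable.of_nonneg_of_le (fun n => mul_nonneg (abs_nonneg _) (cs_nonneg n)) (fun n => ?_) this
    by_cases hn : n = 0
    · subst hn; simp [cs_zero, pf]
    · simp only [hB, hn, if_false, pf, mul_assoc]
      rw [tsum_mul_left, mul_comm]
      apply mul_le_mul_of_nonneg_left _ (cs_nonneg n)
      have h1 := hb.abs.row n hn
      have e : ∀ m, |b m| * ck n m = ‖b m * ck n m‖ := fun m => by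
        rw [Real.norm_eq_abs, abs_mul, abs_of_pos (ck_pos _ _)]
      simp only [e] at h1 ⊢
      exact norm_tsum_le_tsum_norm h1
  let F : ℂ → ℂ := fun z => ∑' n, (B n : ℂ) * cc n z
  have hU : IsOpen {z : ℂ | z.re < 1 / 2} := isOpen_lt Complex.continuous_re continuous_const
  have hF : DifferentiableOn ℂ F {z : ℂ | z.re < 1 / 2} := by
    apply Complex.differentiableOn_tsum_of_summable_norm hsum
    · intro n; exact (cc_diff n).const_mul _
    · exact hU
    · intro n z hz
      rw [norm_mul, Complex.norm_real, Real.norm_eq_abs]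
      exact mul_le_mul_of_nonneg_left (cc_norm_le hz n) (abs_nonneg _)
  have hnear : ∀ z : ℂ, ‖z‖ < 1 / 2 → F z = 0 := by
    intro z hz
    have hz1 : ‖z‖ < 1 := by linarith
    have hS : Summable (Function.uncurry fun (n s : ℕ) => (B n : ℂ) * ((aS s n : ℂ) * z ^ s)) := by
      have hg : Summable fun s : ℕ => (2 * ‖z‖) ^ s :=
        summable_geometric_of_lt_one (by positivity) (by linarith)
      have := hsum.mul_of_nonneg hg (fun n => mul_nonneg (abs_nonneg _) (cs_nonneg n))
        (fun s => by positivity)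
      refine Summable.of_norm_bounded this ?_
      rintro ⟨n, s⟩
      simp only [Function.uncurry]
      rw [norm_mul, norm_mul, norm_pow, Complex.norm_real, Complex.norm_real, Real.norm_eq_abs,
        Real.norm_eq_abs, abs_of_nonneg (aS_nonneg s n), mul_assoc, mul_pow]
      apply mul_le_mul_of_nonneg_left _ (abs_nonneg _)
      calc aS s n * ‖z‖ ^ s ≤ 2 ^ s * cs n * ‖z‖ ^ s := by
            gcongr; exact aS_le_cs s n
        _ = _ := by ring
    have h1 := hS.tsum_comm
    calc F z = ∑' n, ∑' s, (B n : ℂ) * ((aS s n : ℂ) * z ^ s) := by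
          apply tsum_congr
          intro n
          rw [tsum_mul_left, aS_gen hz1]
      _ = ∑' s, ∑' n, (B n : ℂ) * ((aS s n : ℂ) * z ^ s) := h1.symm
      _ = ∑' s : ℕ, 0 := by
          apply tsum_congr
          intro s
          have e : ∀ n, (B n : ℂ) * ((aS s n : ℂ) * z ^ s) = ((aS s n * B n : ℝ) : ℂ) * z ^ s := by
            intro n; push_cast; ring
          simp_rw [e]
          rw [tsum_mul_right, ← Complex.ofReal_tsum, ← hpair (aS s) (Bd_sA _), h s]
          simp
      _ = 0 := tsum_zero
  have hFz : Set.EqOn F 0 {z : ℂ | z.re < 1 / 2} := by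
    apply (hF.analyticOnNhd hU).eqOn_zero_of_preconnected_of_eventuallyEq_zero
    · exact (convex_halfSpace_re_lt _).isPreconnected
    · show (0 : ℂ).re < 1 / 2
      norm_num
    · filter_upwards [Metric.ball_mem_nhds (0 : ℂ) (show (0 : ℝ) < 1 / 2 by norm_num)] with z hz
      exact hnear z (by simpa using hz)
  have hBz : (fun n : ℕ => B n / n) = 0 := by
    apply factorial_unique
    · simp
    · refine Summable.of_nonneg_of_le (fun n => mul_nonneg (abs_nonneg _) (ck_pos _ _).le)
        (fun n => ?_) hsum
      rw [abs_div, Nat.abs_cast, div_mul_eq_mul_div, mul_div_assoc]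
      apply mul_le_mul_of_nonneg_left _ (abs_nonneg _)
      refine le_trans ?_ (seqO_le n)
      have : ck 1 n ≤ 1 := by
        have := ck_antitone 1 (Nat.zero_le n)
        rwa [ck_zero] at this
      gcongr
    · intro N
      have := hFz (show -(((N + 1 : ℕ) : ℂ)) ∈ {z : ℂ | z.re < 1 / 2} by
        simp only [Set.mem_ofPred_eq, Complex.neg_re, Complex.natCast_re]
        have : (0 : ℝ) ≤ ((N + 1 : ℕ) : ℝ) := Nat.cast_nonneg _
        linarith)
      simp only [F, Pi.zero_apply, cc, pp_neg] at this
      have e : ∀ n, (B n : ℂ) * ((ck (N + 1) n : ℂ) / (n : ℂ))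
          = ((B n / n * ck (N + 1) n : ℝ) : ℂ) := by
        intro n; push_cast; ring
      simp_rw [e] at this
      rw [← Complex.ofReal_tsum] at this
      exact_mod_cast this
  apply factorial_unique
  · exact hb.zero
  · exact hb.abs.row 1 one_ne_zero
  · intro N
    have := congrFun hBz (N + 1)
    simp only [Pi.zero_apply, div_eq_zero_iff, Nat.cast_eq_zero, Nat.succ_ne_zero, or_false] at this
    simpa [hB] using this

end


noncomputable section
open Finset Polynomial

/-- Constant ratio from vanishing Wronskian. -/
lemma wr_const (A Q : ℝ[X]) (hQ : Q ≠ 0) (h : Q * derivative A - derivative Q * A = 0) :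
    ∃ c : ℝ, A = C c * Q := by
  -- a polynomial with vanishing Wronskian has the same degree as `Q`
  have key : ∀ P : ℝ[X], P ≠ 0 → Q * derivative P - derivative Q * P = 0 →
      P.natDegree = Q.natDegree := by
    intro P hP hw
    set p := P.natDegree with hp
    set q := Q.natDegree with hq
    have e : Q * derivative P = derivative Q * P := sub_eq_zero.1 hw
    have e' : X * (Q * derivative P) = X * (derivative Q * P) := by rw [e]
    have l1 : (Q * (X * derivative P)).coeff (q + p) = Q.leadingCoeff * (p * P.leadingCoeff) := by
      rw [coeff_mul_add_eq_of_natDegree_le (le_of_eq hq.symm)]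
      · rcases hpp : p with _ | k
        · simp
        · rw [coeff_X_mul, coeff_derivative, leadingCoeff, leadingCoeff, ← hq, ← hp, hpp]
          push_cast; ring
      · rcases hpp : p with _ | k
        · have : derivative P = 0 := derivative_of_natDegree_zero (hp ▸ hpp)
          simp [this]
        · refine natDegree_mul_le.trans ?_
          have := natDegree_derivative_le P
          rw [natDegree_X]; omega
    have l2 : (X * derivative Q * P).coeff (q + p) = (q * Q.leadingCoeff) * P.leadingCoeff := by
      rw [coeff_mul_add_eq_of_natDegree_le _ (le_of_eq hp.symm)]
      · rcases hpp : q with _ | k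
        · simp
        · rw [coeff_X_mul, coeff_derivative, leadingCoeff, leadingCoeff, ← hq, ← hp, hpp]
          push_cast; ring
      · rcases hpp : q with _ | k
        · have : derivative Q = 0 := derivative_of_natDegree_zero (hq ▸ hpp)
          simp [this]
        · refine natDegree_mul_le.trans ?_
          have := natDegree_derivative_le Q
          rw [natDegree_X]; omega
    have e2 : Q * (X * derivative P) = X * derivative Q * P := by linear_combination e'
    rw [e2, l2] at l1
    have n1 := leadingCoeff_ne_zero.2 hP
    have n2 := leadingCoeff_ne_zero.2 hQ
    have : ((q : ℝ) - p) * (Q.leadingCoeff * P.leadingCoeff) = 0 := by linear_combination l1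
    rcases mul_eq_zero.1 this with h | h
    · have : (q : ℝ) = p := sub_eq_zero.1 h
      exact_mod_cast this.symm
    · exact absurd h (mul_ne_zero n2 n1)
  by_cases hA : A = 0
  · exact ⟨0, by simp [hA]⟩
  refine ⟨A.leadingCoeff / Q.leadingCoeff, ?_⟩
  by_contra hne
  set c := A.leadingCoeff / Q.leadingCoeff
  have hP : A - C c * Q ≠ 0 := sub_ne_zero.2 hne
  have hw : Q * derivative (A - C c * Q) - derivative Q * (A - C c * Q) = 0 := by
    rw [derivative_sub, derivative_C_mul]; linear_combination h
  have d1 := key _ hP hw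
  have d2 := key _ hA h
  have n2 := leadingCoeff_ne_zero.2 hQ
  have : (A - C c * Q).coeff Q.natDegree = 0 := by
    rw [coeff_sub, coeff_C_mul, ← d2, coeff_natDegree, d2, coeff_natDegree]
    simp only [c]; field_simp; ring
  rw [← d1] at this
  exact hP (leadingCoeff_eq_zero.1 this)

/-- No logarithm at `0`. -/
lemma no_log_zero (A Q R U : ℝ[X]) (hQ : Q ≠ 0) (hU : U.eval 0 ≠ 0)
    (h : X * U * (Q * derivative A - derivative Q * A) = Q ^ 2 * R) : R.eval 0 = 0 := by
  obtain ⟨a, Q1, hQ1, rfl⟩ : ∃ (a : ℕ) (Q1 : ℝ[X]), Q1.eval 0 ≠ 0 ∧ Q = X ^ a * Q1 := by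
    obtain ⟨Q1, e, hd⟩ := exists_eq_pow_rootMultiplicity_mul_and_not_dvd Q hQ 0
    refine ⟨_, Q1, ?_, by simpa using e⟩
    rw [dvd_iff_isRoot] at hd
    exact hd
  by_cases hA : A = 0
  · subst hA
    have : (X ^ a * Q1) ^ 2 * R = 0 := by rw [← h]; simp
    rcases mul_eq_zero.1 this with h | h
    · exact absurd (pow_eq_zero_iff two_ne_zero |>.1 h) hQ
    · simp [h]
  obtain ⟨b, A1, hA1, rfl⟩ : ∃ (a : ℕ) (Q1 : ℝ[X]), Q1.eval 0 ≠ 0 ∧ A = X ^ a * Q1 := by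
    obtain ⟨Q1, e, hd⟩ := exists_eq_pow_rootMultiplicity_mul_and_not_dvd A hA 0
    refine ⟨_, Q1, ?_, by simpa using e⟩
    rw [dvd_iff_isRoot] at hd
    exact hd
  have hX : (X : ℝ[X]) ≠ 0 := X_ne_zero
  have dX : ∀ n : ℕ, (X : ℝ[X]) * derivative (X ^ n) = C (n : ℝ) * X ^ n := by
    intro n
    rcases n with _ | n
    · simp
    · rw [derivative_X_pow]; simp; ring
  have h' : X ^ (a + b) * (U * (C ((b : ℝ) - a) * (Q1 * A1)
      + X * (Q1 * derivative A1 - derivative Q1 * A1))) = X ^ (2 * a) * (Q1 ^ 2 * R) := by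
    have h2 := h
    rw [derivative_mul, derivative_mul] at h2
    rw [C_sub]
    linear_combination h2 - U * (X ^ a * Q1 * A1) * dX b + U * (X ^ b * Q1 * A1) * dX a
  rcases lt_trichotomy a b with hab | hab | hab
  · obtain ⟨d, rfl⟩ : ∃ d, b = a + d + 1 := ⟨b - a - 1, by omega⟩
    rw [show a + (a + d + 1) = 2 * a + (d + 1) by ring, pow_add, mul_assoc] at h'
    have := congrArg (eval 0) (mul_left_cancel₀ (pow_ne_zero _ hX) h')
    simp at this
    simpa [hQ1] using this
  · subst hab
    rw [show a + a = 2 * a by ring] at h'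
    have := congrArg (eval 0) (mul_left_cancel₀ (pow_ne_zero _ hX) h')
    simp at this
    simpa [hQ1] using this
  · obtain ⟨d, rfl⟩ : ∃ d, a = b + d + 1 := ⟨a - b - 1, by omega⟩
    rw [show 2 * (b + d + 1) = (b + d + 1 + b) + (d + 1) by ring, pow_add _ _ (d + 1), mul_assoc] at h'
    have := congrArg (eval 0) (mul_left_cancel₀ (pow_ne_zero _ hX) h')
    simp [hQ1, hA1, hU] at this
    exfalso
    have hb : (0 : ℝ) ≤ d := d.cast_nonneg
    linarith

lemma no_log (A Q : ℝ[X]) (hQ : Q ≠ 0) (c0 c1 : ℝ)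
    (h : X * (1 - X) * (Q * derivative A - derivative Q * A)
      + Q ^ 2 * (C c0 * (1 - X) + C c1 * X) = 0) : c0 = 0 ∧ c1 = 0 := by
  have aux : ∀ (A Q : ℝ[X]), Q ≠ 0 → ∀ (c0 c1 : ℝ),
    X * (1 - X) * (Q * derivative A - derivative Q * A)
      + Q ^ 2 * (C c0 * (1 - X) + C c1 * X) = 0 → c0 = 0 := by
    intro A Q hQ c0 c1 h
    have := no_log_zero A Q (-(C c0 * (1 - X) + C c1 * X)) (1 - X) hQ (by simp)
      (by linear_combination h)
    simpa using this
  refine ⟨aux A Q hQ c0 c1 h, ?_⟩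
  apply aux (A.comp (1 - X)) (-Q.comp (1 - X)) _ c1 c0
  · have := congrArg (fun p => p.comp (1 - X)) h
    simp only [add_comp, mul_comp, sub_comp, pow_comp, X_comp, one_comp, C_comp, zero_comp] at this
    simp only [derivative_comp, derivative_neg, derivative_sub, derivative_one, derivative_X]
    linear_combination this
  · intro h0
    apply hQ
    have h1 : Q.comp (1 - X) = 0 := by simpa using h0
    have h2 := congrArg (fun p => p.comp (1 - X)) h1
    simpa [comp_assoc] using h2

/-- Index set: `none` is the constant function. -/
abbrev Ix := Option (List Bool)

def par : Ix → Ix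
  | none => none
  | some [] => none
  | some (_ :: w) => some w

def lev : Ix → ℕ
  | none => 0
  | some w => w.length + 1

/-- The letter polynomial (`x ↦ opY ↦ dt/(1-t)`, `y ↦ opX ↦ dt/t`). -/
def th : Ix → ℝ[X]
  | none => 0
  | some [] => X
  | some (b :: _) => if b then 1 - X else X

/-- Words in `ℌ`. -/
def wd (l : List Bool) : H := (l.map (FreeAlgebra.ι ℚ)).prod

def Lf : Ix → PowerSeries ℝ
  | none => 1
  | some w => PowerSeries.mk (sB (wd w))

lemma wd_cons_false (l : List Bool) : wd (false :: l) = Hx * wd l := by simp [wd, Hx]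
lemma wd_cons_true (l : List Bool) : wd (true :: l) = Hy * wd l := by simp [wd, Hy]

lemma deriv_opX (b : ℕ → ℝ) (hb : b 0 = 0) :
    (PowerSeries.X : PowerSeries ℝ) * PowerSeries.derivative ℝ (PowerSeries.mk (opX b))
      = PowerSeries.mk b := by
  ext n
  rcases n with _ | n
  · simp [hb]
  · rw [PowerSeries.coeff_succ_X_mul, PowerSeries.coeff_derivative, PowerSeries.coeff_mk,
      PowerSeries.coeff_mk, opX_apply]
    push_cast
    field_simp

lemma deriv_opY (b : ℕ → ℝ) :
    (1 - PowerSeries.X : PowerSeries ℝ) * PowerSeries.derivative ℝ (PowerSeries.mk (opY b))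
      = PowerSeries.mk b := by
  have e : ∀ n : ℕ, PowerSeries.coeff n (PowerSeries.derivative ℝ (PowerSeries.mk (opY b)))
      = ∑ m ∈ range (n + 1), b m := by
    intro n
    rw [PowerSeries.coeff_derivative, PowerSeries.coeff_mk, opY_apply]
    push_cast
    field_simp
  ext n
  rw [sub_mul, one_mul, map_sub]
  rcases n with _ | n
  · rw [e]; simp
  · rw [PowerSeries.coeff_succ_X_mul, e, e, sum_range_succ _ (n + 1)]
    simp

lemma Lf_deriv (i : Ix) : ((X * (1 - X) : ℝ[X]) : PowerSeries ℝ) * PowerSeries.derivative ℝ (Lf i)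
    = (th i : PowerSeries ℝ) * Lf (par i) := by
  rcases i with _ | _ | ⟨b, w⟩
  · simp [th, Lf]
  · simp only [th, Lf, par, wd, List.map_nil, List.prod_nil]
    have h := deriv_opY seqZ
    rw [opY_seqZ] at h
    have h1 : PowerSeries.mk seqZ = 1 := by
      ext n; simp [seqZ, PowerSeries.coeff_one]
    rw [sB_one]
    push_cast
    rw [mul_assoc, h, h1]
  · cases b
    · simp only [th, Lf, par, wd_cons_false, sB_x_mul]
      have h := deriv_opY (sB (wd w))
      push_cast
      rw [mul_assoc, h]
      try simp
    · simp only [th, Lf, par, wd_cons_true, sB_y_mul]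
      have h := deriv_opX (sB (wd w)) (Bd_sB _).zero
      push_cast
      rw [mul_comm PowerSeries.X, mul_assoc, h]
      try simp

end


noncomputable section
open Finset Polynomial

def LC : (Ix →₀ ℝ[X]) →+ PowerSeries ℝ :=
  Finsupp.liftAddHom fun i =>
    (AddMonoidHom.mulRight (Lf i)).comp (Polynomial.coeToPowerSeries.ringHom (R := ℝ)).toAddMonoidHom

lemma LC_apply (A : Ix →₀ ℝ[X]) : LC A = ∑ i ∈ A.support, (A i : PowerSeries ℝ) * Lf i := by
  simp [LC, Finsupp.liftAddHom_apply, Finsupp.sum]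

lemma LC_single (i : Ix) (p : ℝ[X]) : LC (Finsupp.single i p) = (p : PowerSeries ℝ) * Lf i := by
  simp [LC]

def Ed (Q : ℝ[X]) (A : Ix →₀ ℝ[X]) : Ix →₀ ℝ[X] :=
  ∑ i ∈ A.support, (Finsupp.single i (X * (1 - X) * (Q * derivative (A i) - derivative Q * A i))
    + Finsupp.single (par i) (Q * (A i * th i)))

lemma LC_Ed (Q : ℝ[X]) (A : Ix →₀ ℝ[X]) : LC (Ed Q A) =
    ((X * (1 - X) : ℝ[X]) : PowerSeries ℝ) * ((Q : PowerSeries ℝ) * PowerSeries.derivative ℝ (LC A)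
      - (derivative Q : ℝ[X]) * LC A) := by
  rw [Ed, map_sum, LC_apply A, map_sum, mul_sum, mul_sum, ← sum_sub_distrib, mul_sum]
  apply sum_congr rfl
  intro i _
  rw [map_add, LC_single, LC_single, Derivation.leibniz, PowerSeries.derivative_coe]
  have h := Lf_deriv i
  simp only [smul_eq_mul]
  push_cast at h ⊢
  linear_combination (-(Q : PowerSeries ℝ) * (A i : PowerSeries ℝ)) * h

def chd : Ix → Finset Ix
  | none => {some []}
  | some w => {some (false :: w), some (true :: w)}

lemma mem_chd (i j : Ix) (h : i ∈ chd j) : par i = j := by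
  rcases j with _ | w
  · simp [chd] at h; subst h; rfl
  · simp [chd] at h; rcases h with rfl | rfl <;> rfl

lemma chd_of (i j : Ix) (hi : i ≠ none) (h : par i = j) : i ∈ chd j := by
  subst h
  rcases i with _ | _ | ⟨b, w⟩
  · exact absurd rfl hi
  · simp [par, chd]
  · cases b <;> simp [par, chd]

lemma lev_chd (i j : Ix) (h : i ∈ chd j) : lev i = lev j + 1 := by
  rcases j with _ | w
  · simp [chd] at h; subst h; rfl
  · simp [chd] at h; rcases h with rfl | rfl <;> rfl

lemma Ed_apply (Q : ℝ[X]) (A : Ix →₀ ℝ[X]) (j : Ix) : Ed Q A j =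
    X * (1 - X) * (Q * derivative (A j) - derivative Q * A j)
      + Q * ∑ i ∈ chd j, A i * th i := by
  classical
  rw [Ed, Finsupp.finsetSum_apply]
  simp only [Finsupp.add_apply, Finsupp.single_apply]
  rw [sum_add_distrib]
  congr 1
  · rw [sum_ite_eq']
    split_ifs with h
    · rfl
    · simp [Finsupp.notMem_support_iff.1 h]
  · rw [← sum_filter, mul_sum]
    apply sum_congr_of_eq_on_inter
    · intro i hi hj
      simp only [mem_filter] at hi
      by_cases h : i = none
      · subst h; simp [th]
      · exact absurd (chd_of i j h hi.2) hj
    · intro i hi hj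
      simp only [mem_filter, mem_chd i j hi, and_true] at hj
      simp [Finsupp.notMem_support_iff.1 hj]
    · intros; rfl

lemma indep_aux (n : ℕ) : ∀ A : Ix →₀ ℝ[X], (∀ i, n < lev i → A i = 0) → LC A = 0 → A = 0 := by
  induction n with
  | zero =>
    intro A hA h
    have e : A = Finsupp.single none (A none) := by
      ext1 i
      rcases i with _ | w
      · simp
      · rw [hA _ (by simp [lev])]; simp
    rw [e, LC_single] at h
    simp only [Lf, mul_one] at h
    rw [e, Polynomial.coe_eq_zero_iff.1 h, Finsupp.single_zero]
  | succ n IH =>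
    intro A
    induction hN : #{i ∈ A.support | lev i = n + 1} using Nat.strong_induction_on generalizing A with
    | _ N ih =>
    intro hA h
    by_cases hex : ∃ i, lev i = n + 1 ∧ A i ≠ 0
    swap
    · push Not at hex
      apply IH A _ h
      intro i hi
      by_cases h1 : lev i = n + 1
      · exact hex i h1
      · exact hA i (by omega)
    exfalso
    obtain ⟨i0, hl0, hi0⟩ := hex
    set Q := A i0 with hQ
    have hchd0 : ∀ j, n + 1 ≤ lev j → ∑ i ∈ chd j, A i * th i = 0 := by
      intro j hj
      apply sum_eq_zero
      intro i hi
      rw [hA i (by have := lev_chd i j hi; omega), zero_mul]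
    have hE : Ed Q A = 0 := by
      refine ih _ ?_ (Ed Q A) rfl ?_ ?_
      · rw [← hN]
        apply card_lt_card
        rw [ssubset_iff_of_subset]
        · refine ⟨i0, by simp [hl0, ← hQ, hi0], ?_⟩
          simp only [mem_filter, Finsupp.mem_support_iff, not_and_or, not_not]
          left
          rw [Ed_apply, hchd0 _ hl0.ge, ← hQ]
          ring
        · intro i hi
          simp only [mem_filter, Finsupp.mem_support_iff] at hi ⊢
          refine ⟨fun h0 => hi.1 ?_, hi.2⟩
          rw [Ed_apply, hchd0 _ hi.2.ge, h0]
          simp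
      · intro i hi
        rw [Ed_apply, hchd0 _ hi.le, hA i hi]
        simp
      · rw [LC_Ed, h]; simp
    have hX : (X * (1 - X) : ℝ[X]) ≠ 0 := by
      intro h0
      have := congrArg (eval (2 : ℝ)) h0
      norm_num at this
    have hc : ∀ i, lev i = n + 1 → ∃ c : ℝ, A i = C c * Q := by
      intro i hi
      apply wr_const _ _ hi0
      have := DFunLike.congr_fun hE i
      rw [Ed_apply, hchd0 _ hi.ge, mul_zero, add_zero, Finsupp.zero_apply] at this
      exact (mul_eq_zero.1 this).resolve_left hX
    have hne : i0 ≠ none := by rintro rfl; simp [lev] at hl0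
    have hmem := chd_of i0 _ hne rfl
    have hlp := lev_chd _ _ hmem
    have hj := DFunLike.congr_fun hE (par i0)
    rw [Ed_apply, Finsupp.zero_apply] at hj
    generalize hjj : par i0 = j at *
    rcases j with _ | w
    · simp only [chd, mem_singleton] at hmem
      obtain ⟨c, hc1⟩ := hc (some []) (by rw [← hmem]; exact hl0)
      simp only [chd, sum_singleton, th, hc1] at hj
      have := no_log (A none) Q hi0 0 c (by rw [C_0]; linear_combination hj)
      rw [this.2] at hc1
      apply hi0
      rw [hQ, hmem, hc1]; simp
    · have hl : w.length + 1 = n := by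
        have h5 : lev (some w) = w.length + 1 := rfl
        rw [h5] at hlp

        omega
      obtain ⟨c, hc1⟩ := hc (some (false :: w)) (by simp [lev, hl])
      obtain ⟨d, hd1⟩ := hc (some (true :: w)) (by simp [lev, hl])
      simp only [chd] at hj
      rw [sum_pair (by simp)] at hj
      simp only [th, hc1, hd1, if_true] at hj
      have := no_log (A (some w)) Q hi0 d c (by simp at hj; linear_combination hj)
      simp only [chd, mem_insert, mem_singleton] at hmem
      apply hi0
      rcases hmem with hm | hm
      · rw [hQ, hm, hc1, this.2]; simp
      · rw [hQ, hm, hd1, this.1]; simp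

lemma indep (A : Ix →₀ ℝ[X]) (h : LC A = 0) : A = 0 := by
  apply indep_aux (A.support.sup lev) A _ h
  intro i hi
  by_contra h0
  exact absurd (le_sup (f := lev) (Finsupp.mem_support_iff.2 h0)) (not_le.2 hi)

lemma basis_eq (l : FreeMonoid Bool) : FreeAlgebra.basisFreeMonoid ℚ Bool l = wd (FreeMonoid.toList l) := by
  rw [FreeAlgebra.basisFreeMonoid]
  simp [FreeAlgebra.equivMonoidAlgebraFreeMonoid, wd]
  exact FreeMonoid.lift_apply _ _

/-- `sB` is injective. -/
lemma sB_inj (w : H) (h : sB w = 0) : w = 0 := by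
  set bs := FreeAlgebra.basisFreeMonoid ℚ Bool
  have hw := bs.linearCombination_repr w
  rw [Finsupp.linearCombination_apply, Finsupp.sum] at hw
  let A : Ix →₀ ℝ[X] := ∑ l ∈ (bs.repr w).support,
    Finsupp.single (some (FreeMonoid.toList l)) (C ((bs.repr w l : ℚ) : ℝ))
  have hLC : LC A = 0 := by
    simp only [A, map_sum, LC_single]
    ext n
    have h2 := congrFun h n
    rw [← hw] at h2
    have e : ∀ (s : Finset (FreeMonoid Bool)) (f : FreeMonoid Bool → ℚ),
        sB (∑ l ∈ s, f l • bs l) n = ∑ l ∈ s, (f l : ℝ) * sB (bs l) n := by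
      intro s f
      simp [sB, map_sum, Rat.smul_def]
    rw [e] at h2
    rw [map_sum]
    simp only [Polynomial.coe_C, PowerSeries.coeff_C_mul, Lf, PowerSeries.coeff_mk]
    simpa [bs, basis_eq] using h2
  have hA := indep A hLC
  rw [← hw]
  apply sum_eq_zero
  intro l hl
  have := DFunLike.congr_fun hA (some (FreeMonoid.toList l))
  simp only [A, Finsupp.finsetSum_apply, Finsupp.single_apply, Option.some.injEq,
    EmbeddingLike.apply_eq_iff_eq, Finsupp.zero_apply] at this
  rw [sum_eq_single l (fun x _ hx => if_neg (fun h4 => hx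
    (FreeMonoid.toList.injective (Option.some_inj.1 h4)))) (fun h4 => absurd hl h4),
    if_pos rfl, C_eq_zero] at this
  have h3 : bs.repr w l = 0 := by exact_mod_cast this
  rw [h3, zero_smul]
end


noncomputable section
open Finset
open scoped ENNReal

def Wk (r : ℕ) (k : Fin r → ℕ) : H := (List.ofFn fun i => Hy * Hx ^ (k i - 1)).prod

lemma Wk_succ (r : ℕ) (k : Fin (r + 1) → ℕ) :
    Wk (r + 1) k = Wk r (fun i => k i.castSucc) * (Hy * Hx ^ (k (Fin.last r) - 1)) := by
  rw [Wk, List.ofFn_succ', List.concat_eq_append, List.prod_append, List.prod_singleton, Wk]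

lemma sA_mul_xpow (w : H) (j : ℕ) (n : ℕ) : sA (w * Hx ^ j) n = sA w n / (n : ℝ) ^ j := by
  induction j with
  | zero => simp
  | succ j ih => rw [pow_succ, ← mul_assoc, sA_mul_x, opX_apply, ih, div_div, pow_succ]

lemma sA_Wk_succ (r : ℕ) (k : Fin (r + 1) → ℕ) (hk : ∀ i, 1 ≤ k i) (n : ℕ) :
    sA (Wk (r + 1) k) n =
      (∑ m ∈ range n, sA (Wk r (fun i => k i.castSucc)) m) * (1 / (n : ℝ) ^ (k (Fin.last r))) := by
  rw [Wk_succ, ← mul_assoc, sA_mul_xpow, sA_mul_y, opY_apply, div_div, ← pow_succ',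
    Nat.sub_add_cancel (hk _)]
  ring

lemma sA_Wk_nonneg (r : ℕ) : ∀ (k : Fin r → ℕ), (∀ i, 1 ≤ k i) → ∀ n, 0 ≤ sA (Wk r k) n := by
  induction r with
  | zero =>
    intro k _ n
    simp only [Wk, List.ofFn_zero, List.prod_nil, sA_one, seqZ]
    split_ifs <;> norm_num
  | succ r ih =>
    intro k hk n
    rw [sA_Wk_succ r k hk]
    exact mul_nonneg (sum_nonneg fun m _ => ih _ (fun i => hk _) m) (by positivity)

open Classical in
def Tk (r : ℕ) (k : Fin r → ℕ) (p : ℕ → Prop) : ℝ≥0∞ :=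
  ∑' n : Fin r → ℕ, if (StrictMono n ∧ ∀ i, 0 < n i ∧ p (n i)) then
    ∏ i, ENNReal.ofReal (1 / (n i : ℝ) ^ (k i)) else 0

lemma cond_iff (r : ℕ) (p : ℕ → Prop) (hp : ∀ a b, a ≤ b → p b → p a) (M : ℕ) (n : Fin r → ℕ) :
    (StrictMono (Fin.snoc n M : Fin (r + 1) → ℕ) ∧
      ∀ i, 0 < (Fin.snoc n M : Fin (r + 1) → ℕ) i ∧ p ((Fin.snoc n M : Fin (r + 1) → ℕ) i)) ↔
    ((0 < M ∧ p M) ∧ (StrictMono n ∧ ∀ i, 0 < n i ∧ n i < M)) := by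
  constructor
  · rintro ⟨h1, h2⟩
    refine ⟨by simpa using h2 (Fin.last r), ?_, ?_⟩
    · intro a b hab
      have := h1 (Fin.castSucc_lt_castSucc_iff.2 hab)
      simpa using this
    · intro i
      have := h1 (Fin.castSucc_lt_last i)
      have h3 := (h2 i.castSucc).1
      simp at this h3
      exact ⟨h3, this⟩
  · rintro ⟨⟨h1, h2⟩, h3, h4⟩
    refine ⟨?_, ?_⟩
    · intro a b hab
      induction b using Fin.lastCases with
      | last =>
        induction a using Fin.lastCases with
        | last => exact absurd hab (lt_irrefl _)
        | cast a => simpa using (h4 a).2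
      | cast b =>
        induction a using Fin.lastCases with
        | last => exact absurd hab (not_lt.2 (Fin.le_last _))
        | cast a => simpa using h3 (Fin.castSucc_lt_castSucc_iff.1 hab)
    · intro i
      induction i using Fin.lastCases with
      | last => simpa using ⟨h1, h2⟩
      | cast i => simpa using ⟨(h4 i).1, hp _ _ (h4 i).2.le h2⟩

open Classical in
lemma Tk_succ (r : ℕ) (k : Fin (r + 1) → ℕ) (p : ℕ → Prop) (hp : ∀ a b, a ≤ b → p b → p a) :
    Tk (r + 1) k p = ∑' M : ℕ, if (0 < M ∧ p M) then
      Tk r (fun i => k i.castSucc) (fun m => m < M) *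
        ENNReal.ofReal (1 / (M : ℝ) ^ (k (Fin.last r))) else 0 := by
  rw [Tk, ← (Fin.snocEquiv (fun _ : Fin (r + 1) => ℕ)).tsum_eq, ENNReal.summable.tsum_prod' (fun _ => ENNReal.summable)]
  refine tsum_congr fun M => ?_
  have e : ∀ n : Fin r → ℕ, Fin.snocEquiv (fun _ : Fin (r + 1) => ℕ) (M, n) = Fin.snoc n M :=
    fun n => rfl
  simp only [e, cond_iff r p hp]
  by_cases h : 0 < M ∧ p M
  · simp only [h, true_and, if_true, and_true]
    rw [Tk, ← ENNReal.tsum_mul_right]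
    refine tsum_congr fun n => ?_
    rw [ite_mul, zero_mul]
    congr 1
    rw [Fin.prod_univ_castSucc]
    simp
  · simp [h]

lemma Tk_eq (r : ℕ) : ∀ (k : Fin r → ℕ), (∀ i, 1 ≤ k i) → ∀ N, 0 < N →
    Tk r k (fun m => m < N) = ENNReal.ofReal (∑ m ∈ range N, sA (Wk r k) m) := by
  induction r with
  | zero =>
    intro k _ N hN
    have : (∑ m ∈ range N, sA (Wk 0 k) m) = 1 := by
      simp [Wk, sA_one, seqZ, hN]
    rw [this, Tk]
    simp [Subsingleton.strictMono]
  | succ r ih =>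
    intro k hk N hN
    rw [Tk_succ r k _ (fun a b hab hb => lt_of_le_of_lt hab hb),
      ENNReal.ofReal_sum_of_nonneg (fun i _ => sA_Wk_nonneg _ k hk i)]
    rw [tsum_eq_sum (s := range N)]
    · refine sum_congr rfl fun M hM => ?_
      rw [sA_Wk_succ r k hk]
      by_cases h : 0 < M
      · rw [if_pos ⟨h, mem_range.1 hM⟩, ih _ (fun i => hk _) M h, ENNReal.ofReal_mul]
        exact sum_nonneg fun m _ => sA_Wk_nonneg _ _ (fun i => hk _) m
      · have : M = 0 := by omega
        subst this
        simp
    · intro M hM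
      rw [if_neg]
      rintro ⟨_, h⟩
      exact hM (mem_range.2 h)

lemma MZV_eq (r : ℕ) (k : Fin (r + 1) → ℕ) (hk : ∀ i, 1 ≤ k i) :
    MZV (r + 1) k = ∑' n, sA (Wk (r + 1) k) n := by
  classical
  have h1 : Tk (r + 1) k (fun _ => True) = ∑' n, ENNReal.ofReal (sA (Wk (r + 1) k) n) := by
    rw [Tk_succ r k _ (fun _ _ _ h => h)]
    refine tsum_congr fun M => ?_
    rw [sA_Wk_succ r k hk]
    by_cases h : 0 < M
    · rw [if_pos ⟨h, trivial⟩, Tk_eq r _ (fun i => hk _) M h, ENNReal.ofReal_mul]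
      exact sum_nonneg fun m _ => sA_Wk_nonneg _ _ (fun i => hk _) m
    · have : M = 0 := by omega
      subst this
      simp
  have h2 : (Tk (r + 1) k (fun _ => True)).toReal = MZV (r + 1) k := by
    have e : Tk (r + 1) k (fun _ => True) =
        ∑' n : {n : Fin (r + 1) → ℕ // (∀ i, 0 < n i) ∧ StrictMono n},
          ∏ i, ENNReal.ofReal (1 / (n.1 i : ℝ) ^ (k i)) := by
      have := tsum_subtype {n : Fin (r + 1) → ℕ | (∀ i, 0 < n i) ∧ StrictMono n}
        (fun n => ∏ i, ENNReal.ofReal (1 / (n i : ℝ) ^ (k i)))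
      refine Eq.trans ?_ this.symm
      rw [Tk]
      refine tsum_congr fun n => ?_
      rw [Set.indicator_apply]
      simp only [and_true, Set.mem_ofPred_eq]
      exact if_congr and_comm rfl rfl
    rw [e, ENNReal.tsum_toReal_eq, MZV]
    · refine tsum_congr fun n => ?_
      rw [ENNReal.toReal_prod]
      exact prod_congr rfl fun i _ => ENNReal.toReal_ofReal (by positivity)
    · intro n
      exact ENNReal.prod_ne_top fun i _ => ENNReal.ofReal_ne_top
  rw [← h2, h1, ENNReal.tsum_toReal_eq (fun _ => ENNReal.ofReal_ne_top)]
  exact tsum_congr fun n => ENNReal.toReal_ofReal (sA_Wk_nonneg _ k hk n)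

lemma word_form (l : List Bool) : ∃ (r : ℕ) (k : Fin (r + 1) → ℕ), (∀ i, 1 ≤ k i) ∧
    Hy * wd l = Wk (r + 1) k := by
  induction l using List.reverseRecOn with
  | nil => exact ⟨0, fun _ => 1, fun _ => le_rfl, by simp [Wk, wd]⟩
  | append_singleton l b ih =>
    obtain ⟨r, k, hk, h⟩ := ih
    have e : Hy * wd (l ++ [b]) = Wk (r + 1) k * FreeAlgebra.ι ℚ b := by
      rw [← h]; simp [wd, mul_assoc]
    cases b with
    | false =>
      refine ⟨r, Fin.snoc (fun i => k i.castSucc) (k (Fin.last r) + 1), ?_, ?_⟩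
      · intro i
        induction i using Fin.lastCases with
        | last => simp
        | cast i => simpa using hk _
      · rw [e, Wk_succ, Wk_succ]
        have h3 : k (Fin.last r) = k (Fin.last r) - 1 + 1 := (Nat.sub_add_cancel (hk _)).symm
        simp only [Fin.snoc_castSucc, Fin.snoc_last, Nat.add_sub_cancel]
        have h4 : Hx ^ k (Fin.last r) = Hx ^ (k (Fin.last r) - 1) * Hx := by
          rw [← pow_succ, ← h3]
        rw [h4]
        simp only [mul_assoc, Hx]
    | true =>
      refine ⟨r + 1, Fin.snoc k 1, ?_, ?_⟩
      · intro i
        induction i using Fin.lastCases with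
        | last => simp
        | cast i => simpa using hk _
      · rw [e, Wk_succ (r + 1)]
        simp [Hy]

lemma Z_word (Z : H →ₗ[ℚ] ℝ) (hZ : IsZetaMap Z) (l : List Bool) :
    Z (Hy * wd l * Hx) = ∑' n, sA (Hy * wd l) n / n := by
  obtain ⟨r, k, hk, h⟩ := word_form l
  set k' : Fin (r + 1) → ℕ := Fin.snoc (fun i => k i.castSucc) (k (Fin.last r) + 1) with hk'
  have hk1 : ∀ i, 1 ≤ k' i := by
    intro i
    induction i using Fin.lastCases with
    | last => simp [k']
    | cast i => simpa [k'] using hk _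
  have e : Hy * wd l * Hx = Wk (r + 1) k' := by
    rw [h, Wk_succ, Wk_succ]
    have h3 : k (Fin.last r) = k (Fin.last r) - 1 + 1 := (Nat.sub_add_cancel (hk _)).symm
    simp only [k', Fin.snoc_castSucc, Fin.snoc_last, Nat.add_sub_cancel]
    have h4 : Hx ^ k (Fin.last r) = Hx ^ (k (Fin.last r) - 1) * Hx := by
      rw [← pow_succ, ← h3]
    rw [h4]
    simp only [mul_assoc]
  have h4 := hZ r k' hk1 (by simpa [k'] using hk _)
  rw [MZV_eq r k' hk1] at h4
  rw [e]
  refine h4.trans (tsum_congr fun n => ?_)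
  rw [← e, sA_mul_x, opX_apply]

lemma summable_sA (P : H) : Summable (fun n : ℕ => sA (Hy * P) n / n) := by
  obtain ⟨K, hK⟩ := Bd_sA P
  refine Summable.of_norm_bounded (summable_cs.mul_left K) fun n => ?_
  rw [Real.norm_eq_abs, abs_div, Nat.abs_cast, ← mul_div_assoc]
  exact div_le_div_of_nonneg_right (hK n) n.cast_nonneg

lemma Z_eq (Z : H →ₗ[ℚ] ℝ) (hZ : IsZetaMap Z) (P : H) :
    Z (Hy * P * Hx) = ∑' n, sA (Hy * P) n / n := by
  have hP : P ∈ Submodule.span ℚ (Set.range (FreeAlgebra.basisFreeMonoid ℚ Bool)) := by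
    rw [Module.Basis.span_eq]; trivial
  induction hP using Submodule.span_induction with
  | mem x hx =>
    obtain ⟨l, rfl⟩ := hx
    rw [basis_eq]
    exact Z_word Z hZ _
  | zero => simp [sA]
  | add a b _ _ ha hb =>
    rw [mul_add, add_mul, map_add, ha, hb, ← (summable_sA a).tsum_add (summable_sA b)]
    refine tsum_congr fun n => ?_
    rw [sA_add, Pi.add_apply, add_div]
  | smul q a _ ha =>
    rw [mul_smul_comm, smul_mul_assoc, map_smul, ha, Rat.smul_def, ← tsum_mul_left]
    refine tsum_congr fun n => ?_
    rw [sA_smul, Pi.smul_apply, smul_eq_mul, mul_div_assoc]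

lemma main_aux (Z : H →ₗ[ℚ] ℝ) (hZ : IsZetaMap Z) (w : H)
    (h : ∀ s : ℕ, Z (Hy * (Hx + Hy) ^ s * w * Hx) = 0) : w = 0 := by
  apply sB_inj
  apply vanish (Bd_sB w)
  intro s
  have h1 := transport w ((Hx + Hy) ^ s) 1
  rw [mul_one, sB_one, pair_seqO (Bd_sA _), ← Z_eq Z hZ, ← mul_assoc Hy, h s] at h1
  exact h1
end

/-- For `w ∈ ℌ`, one has `Z(y (x+y)^s w x) = 0` for every `s ≥ 0`
if and only if `w = 0`; equivalently `f(y, wx) = 0 ↔ w = 0`. -/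
theorem statement1 (Z : H →ₗ[ℚ] ℝ) (hZ : IsZetaMap Z) (w : H) :
    (∀ s : ℕ, Z (Hy * (Hx + Hy) ^ s * w * Hx) = 0) ↔ w = 0 := by
  constructor
  · exact main_aux Z hZ w
  · rintro rfl s
    simp

end
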